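/- arXiv:1712.03499 — 8 statements merged into one kernel-verified Lean document; each statement's English description precedes it below -/
import Mathlib

section
/- For every n×d real matrix A (n,d ≥ 1) and every y ∈ ℝ^n, the function R_∞ : ℝ^d → ℝ defined by R_∞(x) = ‖A⊗x − y‖_∞ = max_{i=1,…,n} |(A⊗x)_i − y_i| is max-plus convex: for all x, x' ∈ ℝ^d and all λ, μ ∈ ℝ with max(λ,μ) = 0, letting z_j = max(λ + x_j, μ + x'_j), one has R_∞(z) ≤ max(λ + R_∞(x), μ + R_∞(x')). -/
/-- Max-plus linearity of a finite max-plus linear form. -/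
theorem iSup_add_max_add {ι : Type*} [Finite ι] [Nonempty ι] (a x x' : ι → ℝ) (l m : ℝ) :
    (⨆ j, a j + max (l + x j) (m + x' j)) =
      max (l + ⨆ j, a j + x j) (m + ⨆ j, a j + x' j) := by
  have bdd (f : ι → ℝ) : BddAbove (Set.range f) := (Set.finite_range f).bddAbove
  apply le_antisymm
  · refine ciSup_le fun j => ?_
    have h := le_ciSup (bdd fun j => a j + x j) j
    have h' := le_ciSup (bdd fun j => a j + x' j) j
    rw [← max_add_add_left]
    exact max_le_max (by linarith) (by linarith)
  · refine max_le ?_ ?_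
    · rw [← le_sub_iff_add_le']
      refine ciSup_le fun j => ?_
      have h := le_ciSup (bdd fun j => a j + max (l + x j) (m + x' j)) j
      linarith [le_max_left (l + x j) (m + x' j)]
    · rw [← le_sub_iff_add_le']
      refine ciSup_le fun j => ?_
      have h := le_ciSup (bdd fun j => a j + max (l + x j) (m + x' j)) j
      linarith [le_max_right (l + x j) (m + x' j)]

/-- The distance to a fixed real number is max-plus convex. -/
theorem abs_max_add_sub_le {l m : ℝ} (h : max l m = 0) (u v y : ℝ) :
    |max (l + u) (m + v) - y| ≤ max (l + |u - y|) (m + |v - y|) := by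
  grind


/-- The max-plus ∞-norm residual `R_∞(x) = ‖A⊗x − y‖_∞ = ⨆ i, |(A⊗x)_i − y_i|`
is max-plus convex: for all `x x' : ℝ^d` and `l m : ℝ` with `max l m = 0`,
letting `z j = max (l + x j) (m + x' j)`, one has
`R_∞(z) ≤ max (l + R_∞(x)) (m + R_∞(x'))`. -/
theorem maxplus_inftyNorm_residual_maxplus_convex (n d : ℕ) (hn : 0 < n) (hd : 0 < d)
    (A : Fin n → Fin d → ℝ) (y : Fin n → ℝ) :
    ∀ x x' : Fin d → ℝ, ∀ l m : ℝ, max l m = 0 →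
      (⨆ i, |(⨆ j, A i j + max (l + x j) (m + x' j)) - y i|)
        ≤ max (l + ⨆ i, |(⨆ j, A i j + x j) - y i|)
            (m + ⨆ i, |(⨆ j, A i j + x' j) - y i|) := by
  intro x x' l m h
  have : Nonempty (Fin n) := ⟨⟨0, hn⟩⟩
  have : Nonempty (Fin d) := ⟨⟨0, hd⟩⟩
  have bdd (f : Fin n → ℝ) : BddAbove (Set.range f) := (Set.finite_range f).bddAbove
  refine ciSup_le fun i => ?_
  rw [iSup_add_max_add]
  refine (abs_max_add_sub_le h _ _ _).trans (max_le_max ?_ ?_)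
  · gcongr
    exact le_ciSup (bdd fun i => |(⨆ j, A i j + x j) - y i|) i
  · gcongr
    exact le_ciSup (bdd fun i => |(⨆ j, A i j + x' j) - y i|) i
end

section
/- Let A be an n×d real matrix (n,d ≥ 1) and y ∈ ℝ^n. Define x̂ ∈ ℝ^d by x̂_j = min_{i=1,…,n}(y_i − A_{ij}), let α = ‖A⊗x̂ − y‖_∞, and set x* = x̂ + (α/2)·(1,…,1). Then: (i) ‖A⊗x* − y‖_∞ = α/2 ≤ ‖A⊗x − y‖_∞ for every x ∈ ℝ^d, so x* is a minimizer of the max-plus ∞-norm regression problem; and (ii) every minimizer x of x ↦ ‖A⊗x − y‖_∞ satisfies x_j ≤ x*_j for all j, i.e. x* is the greatest minimizer. -/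
/-- The max-plus product commutes with adding a constant to the vector. -/
theorem iSup_add_add_const {ι : Type*} [Finite ι] [Nonempty ι] (a x : ι → ℝ) (c : ℝ) :
    (⨆ j, a j + (x j + c)) = (⨆ j, a j + x j) + c := by
  rw [ciSup_add (Set.finite_range _).bddAbove]
  simp only [add_assoc]

/-- A vector whose max-plus residual is at most `r` exceeds the principal subsolution by at
most `r`. -/
theorem le_iInf_sub_add_of_abs_iSup_sub_le {m ι : Type*} [Nonempty m] [Finite ι]
    {A : m → ι → ℝ} {y : m → ℝ} {x : ι → ℝ} {r : ℝ}
    (h : ∀ i, |(⨆ j, A i j + x j) - y i| ≤ r) (j : ι) :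
    x j ≤ (⨅ i, (y i - A i j)) + r := by
  rw [← sub_le_iff_le_add]
  refine le_ciInf fun i => ?_
  have hle : A i j + x j ≤ ⨆ j, A i j + x j :=
    le_ciSup (f := fun j => A i j + x j) (Set.finite_range _).bddAbove j
  linarith [(abs_le.mp (h i)).2]


/-- For an n×d real matrix `A` and `y : ℝ^n`, let `x̂ j = ⨅ i, (y i − A i j)`,
`α = ‖A⊗x̂ − y‖_∞` and `x* = x̂ + (α/2)·1`. Then (i) `‖A⊗x* − y‖_∞ = α/2` and
`α/2 ≤ ‖A⊗x − y‖_∞` for all `x`, so `x*` is a minimizer of the max-plus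
∞-norm regression problem; and (ii) every minimizer `x` satisfies `x ≤ x*`
componentwise, i.e. `x*` is the greatest minimizer. -/
theorem maxplus_inftyNorm_regression_greatest_minimizer (n d : ℕ) (hn : 0 < n) (hd : 0 < d)
    (A : Fin n → Fin d → ℝ) (y : Fin n → ℝ)
    (xhat : Fin d → ℝ) (hxhat : ∀ j, xhat j = ⨅ i, (y i - A i j))
    (α : ℝ) (hα : α = ⨆ i, |(⨆ j, A i j + xhat j) - y i|)
    (xstar : Fin d → ℝ) (hxstar : ∀ j, xstar j = xhat j + α / 2) :
    ((⨆ i, |(⨆ j, A i j + xstar j) - y i|) = α / 2 ∧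
      ∀ x : Fin d → ℝ, α / 2 ≤ ⨆ i, |(⨆ j, A i j + x j) - y i|) ∧
    (∀ x : Fin d → ℝ,
      (∀ x' : Fin d → ℝ,
        (⨆ i, |(⨆ j, A i j + x j) - y i|) ≤ ⨆ i, |(⨆ j, A i j + x' j) - y i|) →
      ∀ j, x j ≤ xstar j) := by
  have : Nonempty (Fin n) := ⟨⟨0, hn⟩⟩
  have : Nonempty (Fin d) := ⟨⟨0, hd⟩⟩
  have abs_le_residual (x : Fin d → ℝ) (i : Fin n) :
      |(⨆ j, A i j + x j) - y i| ≤ ⨆ i, |(⨆ j, A i j + x j) - y i| :=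
    le_ciSup (f := fun i => |(⨆ j, A i j + x j) - y i|) (Set.finite_range _).bddAbove i
  have le_xhat_add (x : Fin d → ℝ) (j : Fin d) :
      x j ≤ xhat j + ⨆ i, |(⨆ j, A i j + x j) - y i| := by
    rw [hxhat]
    exact le_iInf_sub_add_of_abs_iSup_sub_le (abs_le_residual x) j
  have xhat_subsolution (i : Fin n) : (⨆ j, A i j + xhat j) ≤ y i := by
    refine ciSup_le fun j => ?_
    have hle : (⨅ i, (y i - A i j)) ≤ y i - A i j :=
      ciInf_le (f := fun i => y i - A i j) (Set.finite_range _).bddBelow i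
    linarith [hxhat j]
  have lower_bound (x : Fin d → ℝ) : α / 2 ≤ ⨆ i, |(⨆ j, A i j + x j) - y i| := by
    suffices hα_le : α ≤ 2 * ⨆ i, |(⨆ j, A i j + x j) - y i| by linarith
    rw [hα]
    refine ciSup_le fun i => ?_
    have hmono : (⨆ j, A i j + x j) ≤
        (⨆ j, A i j + xhat j) + ⨆ i, |(⨆ j, A i j + x j) - y i| := by
      rw [← iSup_add_add_const]
      exact ciSup_mono (Set.finite_range _).bddAbove fun j => by linarith [le_xhat_add x j]
    rw [abs_of_nonpos (by linarith [xhat_subsolution i])]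
    linarith [(abs_le.mp (abs_le_residual x i)).1]
  have residual_xstar : (⨆ i, |(⨆ j, A i j + xstar j) - y i|) = α / 2 := by
    refine le_antisymm (ciSup_le fun i => ?_) (lower_bound xstar)
    simp only [hxstar, iSup_add_add_const]
    have hi := abs_le_residual xhat i
    rw [← hα] at hi
    rw [abs_le]
    constructor <;> linarith [(abs_le.mp hi).1, xhat_subsolution i]
  refine ⟨⟨residual_xstar, lower_bound⟩, fun x hx j => ?_⟩
  rw [hxstar]
  linarith [le_xhat_add x j, hx xstar]
end

section
/- Let A be an n×d real matrix and P = (P_1,…,P_n) a tuple of nonempty subsets of {1,…,d}, with feasibility matrix F_P. Then for every vector x with entries in ℝ ∪ {−∞}, the following are equivalent: (a) for every i = 1,…,n and every j ∈ P_i, A_{ij} + x_j = (A⊗x)_i (i.e. x lies in the closure Cl(X(P)) of the pattern domain, meaning P ⪯ pattern(x)); (b) F_P⊗x = x. -/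
theorem WithBot.coe_sub_add_le_iff (a b : ℝ) (x y : WithBot ℝ) :
    ((a - b : ℝ) : WithBot ℝ) + y ≤ x ↔ (a : WithBot ℝ) + y ≤ (b : WithBot ℝ) + x := by
  induction y with
  | bot => simp
  | coe y =>
    induction x with
    | bot => simp [← WithBot.coe_add]
    | coe x =>
      norm_cast
      constructor <;> intro h <;> linarith

theorem WithBot.finset_sup_add_le_iff {ι : Type*} (s : Finset ι) (f : ι → WithBot ℝ)
    (x y : WithBot ℝ) : s.sup f + y ≤ x ↔ ∀ i ∈ s, f i + y ≤ x := by
  refine ⟨fun h i hi => (add_le_add_left (Finset.le_sup hi) y).trans h, fun h => ?_⟩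
  rcases s.eq_empty_or_nonempty with rfl | hs
  · simp
  · obtain ⟨i, hi, hsup⟩ := s.exists_mem_eq_sup hs f
    rw [hsup]
    exact h i hi

theorem Finset.eq_sup_univ_iff_forall_le {ι α : Type*} [Fintype ι] [SemilatticeSup α] [OrderBot α]
    (f : ι → α) (j : ι) : f j = Finset.univ.sup f ↔ ∀ k, f k ≤ f j := by
  refine ⟨fun h k => h ▸ Finset.le_sup (Finset.mem_univ k), fun h => ?_⟩
  exact le_antisymm (Finset.le_sup (Finset.mem_univ j)) (Finset.sup_le fun k _ => h k)

/-- Closure of a pattern domain as max-plus fixed points of the feasibility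
matrix: for an n×d real matrix `A`, a tuple `P` of nonempty subsets of
`{1,…,d}` with feasibility matrix `F_P` (entries in `ℝ ∪ {−∞}`, modelled by
`WithBot ℝ`), and any vector `x` with entries in `ℝ ∪ {−∞}`, we have
`x ∈ Cl(X(P))` (i.e. `A i j + x j = (A⊗x)_i` for all `i` and all `j ∈ P i`)
if and only if `F_P ⊗ x = x`. -/
theorem closure_pattern_domain_iff_fixed_point (n d : ℕ) (hn : 0 < n) (hd : 0 < d)
    (A : Fin n → Fin d → ℝ) (P : Fin n → Finset (Fin d)) (hP : ∀ i, (P i).Nonempty)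
    (F : Fin d → Fin d → WithBot ℝ)
    (hF : ∀ j k, F j k = if j = k then (0 : WithBot ℝ) else
      (Finset.univ.filter (fun i => j ∈ P i)).sup (fun i => ((A i k - A i j : ℝ) : WithBot ℝ)))
    (x : Fin d → WithBot ℝ) :
    (∀ i : Fin n, ∀ j ∈ P i,
        ((A i j : ℝ) : WithBot ℝ) + x j
          = Finset.univ.sup (fun k => ((A i k : ℝ) : WithBot ℝ) + x k))
      ↔ (∀ j : Fin d, Finset.univ.sup (fun k => F j k + x k) = x j) := by
  have diag (j : Fin d) : F j j + x j = x j := by simp [hF]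
  have entry (j k : Fin d) : F j k + x k ≤ x j ↔
      ∀ i, j ∈ P i → (A i k : WithBot ℝ) + x k ≤ (A i j : WithBot ℝ) + x j := by
    by_cases hjk : j = k
    · subst hjk
      simp [diag]
    · rw [hF, if_neg hjk, WithBot.finset_sup_add_le_iff]
      simp only [WithBot.coe_sub_add_le_iff, Finset.mem_filter, Finset.mem_univ, true_and]
  have row (j : Fin d) : Finset.univ.sup (fun k => F j k + x k) = x j ↔
      ∀ k, F j k + x k ≤ x j := by
    rw [eq_comm]
    simpa only [diag] using Finset.eq_sup_univ_iff_forall_le (fun k => F j k + x k) j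
  have pattern (i : Fin n) (j : Fin d) :=
    Finset.eq_sup_univ_iff_forall_le (fun k => (A i k : WithBot ℝ) + x k) j
  simp only [pattern, row, entry]
  exact ⟨fun h j k i hj => h i j hj k, fun h i j hj k => h j k i hj⟩
end

section
/- Let A be an n×d real matrix, P = (P_1,…,P_n) a tuple of nonempty subsets of {1,…,d} with feasibility matrix F_P, and let S = ⋃_{i=1}^n P_i be the support of P. Then for every c ∈ ℝ^d the following are equivalent: (a) there exists a vector x with entries in ℝ ∪ {−∞} such that x_j = c_j for all j ∈ S and F_P⊗x = x; (b) F_P⊗x₀ = x₀, where x₀ is the vector defined by (x₀)_j = c_j for j ∈ S and (x₀)_j = −∞ for j ∉ S. (This is the admissibility criterion of the paper: the normal projection Φ(P,y) is admissible if and only if the point Ψ(P,y,−∞), which agrees with the projection coefficients on the support of P and equals −∞ elsewhere, is a max-plus fixed point of F_P.) -/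
/-- Admissibility criterion: let `A` be an n×d real matrix, `P` a tuple of
nonempty subsets of `{1,…,d}` with feasibility matrix `F_P` (entries in
`ℝ ∪ {−∞}`, modelled by `WithBot ℝ`), and `S = ⋃ i, P i` the support of `P`.
For every `c : ℝ^d`, there exists a vector `x` over `ℝ ∪ {−∞}` agreeing with
`c` on `S` and satisfying `F_P ⊗ x = x` if and only if the specific vector
`x₀` (equal to `c` on `S` and `−∞` off `S`) satisfies `F_P ⊗ x₀ = x₀`. -/
theorem admissibility_criterion (n d : ℕ) (hn : 0 < n) (hd : 0 < d)
    (A : Fin n → Fin d → ℝ) (P : Fin n → Finset (Fin d)) (hP : ∀ i, (P i).Nonempty)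
    (F : Fin d → Fin d → WithBot ℝ)
    (hF : ∀ j k, F j k = if j = k then (0 : WithBot ℝ) else
      (Finset.univ.filter (fun i => j ∈ P i)).sup (fun i => ((A i k - A i j : ℝ) : WithBot ℝ)))
    (S : Finset (Fin d)) (hS : ∀ j, j ∈ S ↔ ∃ i, j ∈ P i)
    (c : Fin d → ℝ)
    (x₀ : Fin d → WithBot ℝ)
    (hx₀ : ∀ j, x₀ j = if j ∈ S then ((c j : ℝ) : WithBot ℝ) else ⊥) :
    (∃ x : Fin d → WithBot ℝ, (∀ j ∈ S, x j = ((c j : ℝ) : WithBot ℝ)) ∧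
        ∀ j : Fin d, Finset.univ.sup (fun k => F j k + x k) = x j)
      ↔ (∀ j : Fin d, Finset.univ.sup (fun k => F j k + x₀ k) = x₀ j) := by
  have hdiag : ∀ j, F j j = 0 := fun j => by simp [hF]
  refine ⟨?_, fun h => ⟨x₀, fun j hj => by simp [hx₀, hj], h⟩⟩
  rintro ⟨x, hxS, hx⟩ j
  have hle : ∀ k, x₀ k ≤ x k := fun k => by
    by_cases hk : k ∈ S
    · simp [hx₀, hk, hxS k hk]
    · simp [hx₀, hk]
  apply le_antisymm
  · by_cases hj : j ∈ S
    · calc Finset.univ.sup (fun k => F j k + x₀ k)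
          ≤ Finset.univ.sup (fun k => F j k + x k) :=
            Finset.sup_mono_fun fun k _ => add_le_add le_rfl (hle k)
        _ = x₀ j := by rw [hx j, hxS j hj, hx₀, if_pos hj]
    · refine Finset.sup_le fun k _ => ?_
      by_cases hjk : j = k
      · subst hjk
        rw [hdiag, zero_add]
      · have hempty : Finset.univ.filter (fun i => j ∈ P i) = ∅ :=
          Finset.filter_eq_empty_iff.2 fun i _ hi => hj ((hS j).2 ⟨i, hi⟩)
        rw [hF, if_neg hjk, hempty, Finset.sup_empty, WithBot.bot_add]
        exact bot_le
  · calc x₀ j = F j j + x₀ j := by rw [hdiag, zero_add]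
      _ ≤ _ := Finset.le_sup (f := fun k => F j k + x₀ k) (Finset.mem_univ j)
end

section
/- Let A be an n×d matrix with entries in {0,−∞} such that every row has at least one 0 entry, and let y ∈ ℝ^n. Then z ∈ ℝ^d is a descent direction for the point 0 ∈ ℝ^d if and only if Σ_{i=1}^n (A⊗z)_i · y_i > 0, where (A⊗z)_i = max{z_j : A_{ij} = 0}. -/
/-- Along the ray through `z`, a least-squares residual whose model is positively homogeneous
is a quadratic polynomial in the step size. -/
lemma half_sum_sq_smul_sub {ι : Type*} [Fintype ι] (w y : ι → ℝ) (μ : ℝ) :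
    (1 / 2) * ∑ i, (μ * w i - y i) ^ 2 =
      (1 / 2) * ∑ i, (0 - y i) ^ 2 + ((1 / 2) * μ ^ 2 * ∑ i, w i ^ 2 - μ * ∑ i, w i * y i) := by
  simp only [Finset.mul_sum, ← Finset.sum_sub_distrib, ← Finset.sum_add_distrib]
  exact Finset.sum_congr rfl fun i _ => by ring

/-- A quadratic `S μ² / 2 - T μ` with `0 ≤ S` is negative for all small positive `μ` if and only
if `T` is positive. -/
lemma exists_forall_quadratic_neg_iff {S T : ℝ} (hS : 0 ≤ S) :
    (∃ ε > (0 : ℝ), ∀ μ : ℝ, 0 < μ → μ ≤ ε → (1 / 2) * μ ^ 2 * S - μ * T < 0) ↔ 0 < T := by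
  constructor
  · rintro ⟨ε, hε, h⟩
    have h₁ := h ε hε le_rfl
    have h₂ : 0 ≤ (1 / 2) * ε ^ 2 * S := by positivity
    exact pos_of_mul_pos_right (by linarith : 0 < ε * T) hε.le
  · intro hT
    refine ⟨T / (S + 1), by positivity, fun μ hμ hle => ?_⟩
    rw [le_div_iff₀ (by positivity)] at hle
    have h₁ : 0 ≤ μ * S := by positivity
    have h₂ : 0 < μ * (T - (1 / 2) * (μ * S)) := mul_pos hμ (by linarith)
    linarith

/-- Descent-direction criterion at `0` for a `{0, −∞}` matrix: let `A` be an
n×d matrix with entries in `{0, −∞}` (modelled over `WithBot ℝ`) such that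
every row has at least one `0` entry, let `y ∈ ℝ^n`, and let
`R(x) = ½ ∑ i, ((A⊗x)_i − y_i)²` where `(A⊗x)_i = max {x_j : A i j = 0}`.
Then `z ∈ ℝ^d` is a descent direction for the point `0` if and only if
`∑ i, (A⊗z)_i · y_i > 0`. -/
theorem descent_direction_iff_inner_pos (n d : ℕ) (hn : 0 < n) (hd : 0 < d)
    (A : Fin n → Fin d → WithBot ℝ)
    (hval : ∀ i j, A i j = 0 ∨ A i j = ⊥)
    (hrow : ∀ i : Fin n, (Finset.univ.filter fun j => A i j = (0 : WithBot ℝ)).Nonempty)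
    (y : Fin n → ℝ)
    (R : (Fin d → ℝ) → ℝ)
    (hR : ∀ x, R x = (1 / 2) * ∑ i,
      (((Finset.univ.filter fun j => A i j = (0 : WithBot ℝ)).sup' (hrow i) x) - y i) ^ 2)
    (z : Fin d → ℝ) :
    (∃ ε > (0 : ℝ), ∀ μ : ℝ, 0 < μ → μ ≤ ε → R (fun j => μ * z j) < R 0)
      ↔ 0 < ∑ i,
          ((Finset.univ.filter fun j => A i j = (0 : WithBot ℝ)).sup' (hrow i) z) * y i := by
  have hsmul : ∀ μ : ℝ, 0 < μ → ∀ i,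
      (Finset.univ.filter fun j => A i j = (0 : WithBot ℝ)).sup' (hrow i) (fun j => μ * z j) =
        μ * (Finset.univ.filter fun j => A i j = (0 : WithBot ℝ)).sup' (hrow i) z :=
    fun μ hμ i => (Finset.mul₀_sup' hμ.le z _ (hrow i)).symm
  have hzero : R 0 = (1 / 2) * ∑ i, (0 - y i) ^ 2 := by
    rw [hR]
    simp only [Pi.zero_def, Finset.sup'_const]
  rw [← exists_forall_quadratic_neg_iff (Finset.sum_nonneg fun i _ => sq_nonneg
    ((Finset.univ.filter fun j => A i j = (0 : WithBot ℝ)).sup' (hrow i) z))]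
  refine exists_congr fun ε => and_congr_right fun _ => forall_congr' fun μ =>
    forall_congr' fun hμ => imp_congr_right fun _ => ?_
  rw [hzero, hR]
  simp only [hsmul μ hμ]
  rw [half_sum_sq_smul_sub, add_lt_iff_neg_left]
end

section
/- Let A be an n×d matrix with entries in {0,−∞} such that every row has at least one 0 entry, and let y ∈ ℝ^n with Σ_{i=1}^n y_i = 0. If the point 0 ∈ ℝ^d has a descent direction z ∈ ℝ^d, then it has a descent direction z' ∈ {0,1}^d, i.e. a descent direction all of whose components are 0 or 1. -/
/-- Layer-cake argument: if the weights `y` sum to zero and correlate positively with `f`, then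
they have positive total mass on some strict superlevel set of `f`. -/
theorem exists_superlevel_sum_pos {ι : Type*} [Fintype ι] (f y : ι → ℝ) (hy : ∑ i, y i = 0)
    (h : 0 < ∑ i, f i * y i) : ∃ t : ℝ, 0 < ∑ i, (if t < f i then 1 else 0) * y i := by
  by_contra! hneg
  obtain ⟨c, hc⟩ := (Set.finite_range f).bddBelow
  have hc' : ∀ i, c ≤ f i := fun i => hc ⟨i, rfl⟩
  have hint : ∫ t : ℝ, ∑ i, (Set.Ico c (f i)).indicator (fun _ => (1 : ℝ)) t * y i =
      ∑ i, (f i - c) * y i := by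
    rw [MeasureTheory.integral_finsetSum]
    · refine Finset.sum_congr rfl fun i _ => ?_
      rw [MeasureTheory.integral_mul_const, MeasureTheory.integral_indicator measurableSet_Ico]
      simp [hc' i]
    · intro i _
      refine MeasureTheory.Integrable.mul_const ?_ _
      rw [MeasureTheory.integrable_indicator_iff measurableSet_Ico]
      exact MeasureTheory.integrableOn_const (by simp)
  have hle : ∫ t : ℝ, ∑ i, (Set.Ico c (f i)).indicator (fun _ => (1 : ℝ)) t * y i ≤ 0 := by
    refine MeasureTheory.integral_nonpos fun t => ?_
    by_cases ht : c ≤ t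
    · simpa [Set.indicator_apply, ht] using hneg t
    · simp [ht]
  have hsum : ∑ i, (f i - c) * y i = ∑ i, f i * y i := by
    simp [sub_mul, Finset.sum_sub_distrib, ← Finset.mul_sum, hy]
  linarith

/-- Moving `0` slightly along `m` decreases the squared distance to `y` if and only if `m` and `y`
have positive inner product. -/
theorem exists_forall_half_sum_sq_lt_iff {ι : Type*} [Fintype ι] (m y : ι → ℝ) :
    (∃ ε > (0 : ℝ), ∀ μ : ℝ, 0 < μ → μ ≤ ε →
      (1 / 2) * ∑ i, (μ * m i - y i) ^ 2 < (1 / 2) * ∑ i, (0 - y i) ^ 2) ↔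
      0 < ∑ i, m i * y i := by
  have expand (μ : ℝ) : ∑ i, (μ * m i - y i) ^ 2 =
      μ * (μ * ∑ i, m i ^ 2 - 2 * ∑ i, m i * y i) + ∑ i, (0 - y i) ^ 2 := by
    simp only [Finset.mul_sum, ← Finset.sum_sub_distrib, ← Finset.sum_add_distrib]
    exact Finset.sum_congr rfl fun i _ => by ring
  have hq : 0 ≤ ∑ i, m i ^ 2 := Finset.sum_nonneg fun i _ => sq_nonneg _
  simp only [expand]
  generalize ∑ i, m i ^ 2 = q at hq ⊢
  generalize ∑ i, m i * y i = b
  constructor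
  · rintro ⟨ε, hε, h⟩
    by_contra! hb
    have h1 := h ε hε le_rfl
    have h2 : 0 ≤ ε * (ε * q - 2 * b) :=
      mul_nonneg hε.le (by linarith [mul_nonneg hε.le hq])
    linarith
  · intro hb
    refine ⟨b / (q + 1), by positivity, fun μ hμ hle => ?_⟩
    rw [le_div_iff₀ (by positivity)] at hle
    have : μ * (μ * q - 2 * b) < 0 := mul_neg_of_pos_of_neg hμ (by linarith)
    linarith

/-- Multiplication by a nonnegative scalar commutes with `Finset.sup'`. -/
theorem sup'_const_mul {ι : Type*} (s : Finset ι) (hs : s.Nonempty) (x : ι → ℝ) {μ : ℝ}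
    (hμ : 0 ≤ μ) : s.sup' hs (fun j => μ * x j) = μ * s.sup' hs x :=
  (Finset.apply_sup'_eq_sup'_comp hs (μ * ·) fun a b => mul_max_of_nonneg a b hμ).symm

/-- The maximum of a thresholded vector is the thresholded maximum. -/
theorem sup'_threshold {ι : Type*} (s : Finset ι) (hs : s.Nonempty) (x : ι → ℝ) (t : ℝ) :
    s.sup' hs (fun j => if t < x j then (1 : ℝ) else 0) =
      if t < s.sup' hs x then 1 else 0 := by
  refine (Finset.apply_sup'_eq_sup'_comp hs (fun a : ℝ => if t < a then (1 : ℝ) else 0)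
    fun a b => ?_).symm
  by_cases ha : t < a <;> by_cases hb : t < b <;> simp [ha, hb]


/-- If the point `0` has a descent direction, it has a `{0,1}`-valued descent
direction: let `A` be an n×d matrix with entries in `{0, −∞}` (modelled over
`WithBot ℝ`) such that every row has at least one `0` entry, let `y ∈ ℝ^n`
with `∑ i, y i = 0`, and let `R(x) = ½ ∑ i, ((A⊗x)_i − y_i)²` where
`(A⊗x)_i = max {x_j : A i j = 0}`. If `z ∈ ℝ^d` is a descent direction for
the point `0`, then there is a descent direction `z'` all of whose components
are `0` or `1`. -/
theorem descent_direction_zero_one (n d : ℕ) (hn : 0 < n) (hd : 0 < d)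
    (A : Fin n → Fin d → WithBot ℝ)
    (hval : ∀ i j, A i j = 0 ∨ A i j = ⊥)
    (hrow : ∀ i : Fin n, (Finset.univ.filter fun j => A i j = (0 : WithBot ℝ)).Nonempty)
    (y : Fin n → ℝ) (hy : ∑ i, y i = 0)
    (R : (Fin d → ℝ) → ℝ)
    (hR : ∀ x, R x = (1 / 2) * ∑ i,
      (((Finset.univ.filter fun j => A i j = (0 : WithBot ℝ)).sup' (hrow i) x) - y i) ^ 2)
    (z : Fin d → ℝ)
    (hz : ∃ ε > (0 : ℝ), ∀ μ : ℝ, 0 < μ → μ ≤ ε → R (fun j => μ * z j) < R 0) :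
    ∃ z' : Fin d → ℝ, (∀ j, z' j = 0 ∨ z' j = 1) ∧
      ∃ ε > (0 : ℝ), ∀ μ : ℝ, 0 < μ → μ ≤ ε → R (fun j => μ * z' j) < R 0 := by
  have key (x : Fin d → ℝ) : (∃ ε > (0 : ℝ), ∀ μ : ℝ, 0 < μ → μ ≤ ε →
      R (fun j => μ * x j) < R 0) ↔ 0 < ∑ i, (Finset.univ.filter fun j =>
        A i j = (0 : WithBot ℝ)).sup' (hrow i) x * y i := by
    rw [← exists_forall_half_sum_sq_lt_iff]
    refine exists_congr fun ε => and_congr_right fun _ => forall_congr' fun μ =>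
      forall_congr' fun hμ => ?_
    have h0 (i : Fin n) : (Finset.univ.filter fun j =>
        A i j = (0 : WithBot ℝ)).sup' (hrow i) (0 : Fin d → ℝ) = 0 :=
      Finset.sup'_const (hrow i) 0
    simp only [hR, sup'_const_mul _ _ _ hμ.le, h0]
  obtain ⟨t, ht⟩ := exists_superlevel_sum_pos _ y hy ((key z).1 hz)
  refine ⟨fun j => if t < z j then 1 else 0, fun j => (ite_eq_or_eq _ _ _).symm, (key _).2 ?_⟩
  simpa only [sup'_threshold] using ht
end

section
/- For the set-cover reduction matrix A and vector y constructed from a covering family F_1,…,F_m ⊆ {1,…,n} and an integer 1 < k < m, the following evaluation holds: for every nonempty J ⊆ {1,…,m}, letting z ∈ {0,1}^m be the indicator vector of J, p = |J|, and q = |⋃_{j∈J} F_j|, one has Σ_{i=1}^N (A⊗z)_i · y_i = (q − n)·c + (m − p)(p − k)/2, where c = −((m−k−1)/2 + 1)·m² and (A⊗z)_i = max{z_j : A_{ij} = 0}. -/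
/-- The maximum of an indicator vector over a nonempty set detects whether the set meets `J`. -/
theorem sup'_indicator_eq_ite {ι : Type*} [DecidableEq ι] (J s : Finset ι) (hs : s.Nonempty)
    (z : ι → ℝ) (hz : ∀ j, z j = if j ∈ J then 1 else 0) :
    s.sup' hs z = if Disjoint s J then 0 else 1 := by
  split_ifs with h
  · have hzero : ∀ j ∈ s, z j = 0 := fun j hj => by
      rw [hz, if_neg (Finset.disjoint_left.mp h hj)]
    rw [Finset.sup'_congr hs rfl hzero, Finset.sup'_const]
  · obtain ⟨j, hjs, hjJ⟩ := Finset.not_disjoint_iff.mp h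
    apply le_antisymm
    · refine Finset.sup'_le hs z fun i _ => ?_
      rw [hz]
      split_ifs <;> norm_num
    · calc (1 : ℝ) = z j := by rw [hz, if_pos hjJ]
        _ ≤ s.sup' hs z := Finset.le_sup' z hjs

/-- The number of `r`-element subsets of a finite type that meet `J`. -/
theorem sum_card_eq_ite_disjoint {ι : Type*} [Fintype ι] [DecidableEq ι] (J : Finset ι) (r : ℕ) :
    (∑ s : {s : Finset ι // s.card = r}, if Disjoint s.1 J then (0 : ℝ) else 1)
      = ((Fintype.card ι).choose r : ℝ) - ((Fintype.card ι - J.card).choose r : ℝ) := by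
  rw [← Finset.sum_subtype (Finset.powersetCard r Finset.univ)
    (fun s => by simp [Finset.mem_powersetCard])
    (fun s : Finset ι => if Disjoint s J then (0 : ℝ) else 1)]
  have hcompl : (Finset.powersetCard r Finset.univ).filter (fun s => Disjoint s J)
      = Finset.powersetCard r Jᶜ := by
    ext s
    simp [Finset.mem_powersetCard, Finset.subset_compl_iff_disjoint_right, and_comm]
  have hflip : ∀ s : Finset ι, (if Disjoint s J then (0 : ℝ) else 1)
      = 1 - if Disjoint s J then (1 : ℝ) else 0 := fun s => by
    split_ifs <;> norm_num
  simp only [hflip]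
  rw [Finset.sum_sub_distrib, Finset.sum_boole, hcompl]
  simp [Finset.card_powersetCard, Finset.card_compl]


/-- Evaluation of the inner product in the set-cover reduction: given a
covering family `F 1, …, F m ⊆ {1,…,n}` and `1 < k < m`, with parameters
`a = −(m−k−1)/2`, `b = 1`, `c = −((m−k−1)/2 + 1)·m²` and the reduction matrix
`A` (rows indexed by elements of `{1,…,n}`, by singletons of `{1,…,m}`, by
unordered pairs of `{1,…,m}`, and one all-zeros row) and vector `y`
(`y = c` on element rows, `a` on singleton rows, `b` on pair rows, and
`−nc − ma − m(m−1)b/2` on the last row): for every nonempty `J ⊆ {1,…,m}`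
with indicator vector `z`, `p = |J|` and `q = |⋃_{j∈J} F j|`, one has
`∑ i, (A⊗z)_i · y_i = (q − n)·c + (m − p)(p − k)/2`, where on each row
`(A⊗z)_i = max {z_j : A i j = 0}`. -/
theorem set_cover_reduction_inner_product_eval (n m k : ℕ) (hn : 0 < n)
    (hk : 1 < k) (hkm : k < m)
    (F : Fin m → Finset (Fin n))
    (hcov : ∀ i : Fin n, ∃ j, i ∈ F j)
    (a b c : ℝ)
    (ha : a = -(((m : ℝ) - k - 1) / 2)) (hb : b = 1)
    (hc : c = -((((m : ℝ) - k - 1) / 2 + 1) * (m : ℝ) ^ 2))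
    (J : Finset (Fin m)) (hJ : J.Nonempty)
    (z : Fin m → ℝ) (hz : ∀ j, z j = if j ∈ J then 1 else 0)
    (p q : ℕ) (hp : p = J.card) (hq : q = (J.biUnion F).card) :
    (∑ i : Fin n,
        ((Finset.univ.filter fun j => i ∈ F j).sup'
          (by obtain ⟨j, hj⟩ := hcov i; exact ⟨j, by simp [hj]⟩) z) * c)
      + (∑ j : Fin m, z j * a)
      + (∑ s : {s : Finset (Fin m) // s.card = 2},
          (s.1.sup' (Finset.card_pos.mp (by rw [s.2]; norm_num)) z) * b)
      + (Finset.univ.sup' (Finset.univ_nonempty_iff.mpr ⟨⟨0, by omega⟩⟩) z)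
          * (-(n : ℝ) * c - (m : ℝ) * a - (m : ℝ) * ((m : ℝ) - 1) / 2 * b)
      = ((q : ℝ) - (n : ℝ)) * c + ((m : ℝ) - (p : ℝ)) * ((p : ℝ) - (k : ℝ)) / 2 := by
  have hpm : p ≤ m := by simpa [hp] using J.card_le_univ
  have hcover : ∀ i : Fin n, (if Disjoint (Finset.univ.filter fun j => i ∈ F j) J
      then (0 : ℝ) else 1) = if i ∈ J.biUnion F then 1 else 0 := fun i => by
    have h : Disjoint (Finset.univ.filter fun j => i ∈ F j) J ↔ i ∉ J.biUnion F := by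
      simp only [Finset.disjoint_left, Finset.mem_filter, Finset.mem_univ, true_and,
        Finset.mem_biUnion, not_exists, not_and]
      exact forall_congr' fun j => imp_not_comm
    simp only [h, ite_not]
  have hlast : ¬ Disjoint Finset.univ J := by
    simpa [Finset.disjoint_left, Finset.Nonempty] using hJ
  simp only [sup'_indicator_eq_ite J _ _ z hz, hcover, if_neg hlast, ← Finset.sum_mul,
    sum_card_eq_ite_disjoint]
  simp only [hz, Finset.sum_boole, Finset.filter_univ_mem, ← hp, ← hq, Fintype.card_fin,
    Nat.cast_choose_two, Nat.cast_sub hpm, ha, hb]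
  ring
end

section
/- For the set-cover reduction matrix A and vector y constructed from a covering family F_1,…,F_m ⊆ {1,…,n} and an integer 1 < k < m, the following equivalence holds: there exists a subset J ⊆ {1,…,m} with |J| = k − 1 and ⋃_{j∈J} F_j = {1,…,n} if and only if there exists a nonempty subset J' ⊆ {1,…,m} whose indicator vector z ∈ {0,1}^m satisfies Σ_{i=1}^N (A⊗z)_i · y_i < 0. -/
/-- The maximum of an indicator function over a nonempty finite set. -/
lemma sup'_indicator_eq {α : Type*} [DecidableEq α] (s t : Finset α) (hs : s.Nonempty) :
    s.sup' hs (fun j => if j ∈ t then (1 : ℝ) else 0) = 1 - if Disjoint s t then 1 else 0 := by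
  split_ifs with h
  · rw [sub_self]
    refine Finset.sup'_eq_of_forall hs _ fun j hj => ?_
    rw [if_neg (Finset.disjoint_left.mp h hj)]
  · obtain ⟨j, hj, hjt⟩ := Finset.not_disjoint_iff.mp h
    rw [sub_zero]
    apply le_antisymm
    · refine Finset.sup'_le hs _ fun i _ => ?_
      split_ifs <;> norm_num
    · have := Finset.le_sup' (fun j => if j ∈ t then (1 : ℝ) else 0) hj
      rwa [if_pos hjt] at this

/-- The number of pairs meeting `t`, written as a sum of maxima of the indicator of `t`. -/
lemma sum_pairs_sup'_indicator {α : Type*} [Fintype α] [DecidableEq α] (t : Finset α)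
    (h : ∀ s : {s : Finset α // s.card = 2}, s.1.Nonempty) :
    ∑ s : {s : Finset α // s.card = 2}, s.1.sup' (h s) (fun j => if j ∈ t then (1 : ℝ) else 0)
      = ((Fintype.card α).choose 2 : ℝ) - (tᶜ.card.choose 2 : ℝ) := by
  have key : ∑ s : {s : Finset α // s.card = 2}, (if Disjoint s.1 t then (1 : ℝ) else 0)
      = (tᶜ.card.choose 2 : ℝ) := by
    rw [← Finset.sum_subtype (Finset.powersetCard 2 (Finset.univ : Finset α))
      (by simp [Finset.mem_powersetCard])
      (fun s => if Disjoint s t then (1 : ℝ) else 0), Finset.sum_boole,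
      ← Finset.card_powersetCard]
    congr 2
    ext s
    simp [Finset.mem_powersetCard, Finset.subset_compl_iff_disjoint_right, and_comm]
  simp only [sup'_indicator_eq, Finset.sum_sub_distrib, key]
  simp [Fintype.card_finset_len]

/-- If `u` elements are left uncovered by a nonempty family of size `m - q`, the reduced inner
product `-u c - q a - q (q - 1) / 2` is negative exactly when `u = 0` and the family has fewer
than `k` members. -/
lemma reduced_inner_product_neg_iff {m k q u : ℕ} (hk : 1 < k) (hkm : k < m) (hq : q < m) :
    (u : ℝ) * ((((m : ℝ) - k - 1) / 2 + 1) * (m : ℝ) ^ 2) + q * (((m : ℝ) - k - q) / 2) < 0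
      ↔ u = 0 ∧ m < q + k := by
  have hk' : (k : ℝ) + 1 ≤ m := by exact_mod_cast hkm
  have hq' : (q : ℝ) + 1 ≤ m := by exact_mod_cast hq
  have hk0 : (1 : ℝ) < k := by exact_mod_cast hk
  have hq0 : (0 : ℝ) ≤ q := q.cast_nonneg
  constructor
  · intro h
    have hu : u = 0 := by
      by_contra hu
      have hu' : (1 : ℝ) ≤ u := by exact_mod_cast Nat.one_le_iff_ne_zero.mpr hu
      have h1 : (m : ℝ) ^ 2 ≤ (((m : ℝ) - k - 1) / 2 + 1) * (m : ℝ) ^ 2 :=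
        le_mul_of_one_le_left (sq_nonneg _) (by linarith)
      have h2 : (m : ℝ) ^ 2 ≤ u * ((((m : ℝ) - k - 1) / 2 + 1) * (m : ℝ) ^ 2) :=
        h1.trans (le_mul_of_one_le_left ((sq_nonneg _).trans h1) hu')
      nlinarith
    subst hu
    refine ⟨rfl, ?_⟩
    by_contra! hmq
    have hmq' : (q : ℝ) + k ≤ m := by exact_mod_cast hmq
    have : 0 ≤ (q : ℝ) * (((m : ℝ) - k - q) / 2) := mul_nonneg hq0 (by linarith)
    simp only [Nat.cast_zero, zero_mul, zero_add] at h
    linarith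
  · rintro ⟨rfl, hmq⟩
    have hmq' : (m : ℝ) < q + k := by exact_mod_cast hmq
    simp only [Nat.cast_zero, zero_mul, zero_add]
    exact mul_neg_of_pos_of_neg (by linarith) (by linarith)

/-- Set-cover reduction equivalence: given a covering family
`F 1, …, F m ⊆ {1,…,n}` and `1 < k < m`, with parameters `a = −(m−k−1)/2`,
`b = 1`, `c = −((m−k−1)/2 + 1)·m²` and the reduction matrix `A` (rows indexed
by elements of `{1,…,n}`, singletons of `{1,…,m}`, unordered pairs of
`{1,…,m}`, and one all-zeros row) and vector `y` (`c` on element rows, `a` on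
singleton rows, `b` on pair rows, `−nc − ma − m(m−1)b/2` on the last row):
there exists `J ⊆ {1,…,m}` with `|J| = k − 1` and `⋃_{j∈J} F j = {1,…,n}`
if and only if there exists a nonempty `J' ⊆ {1,…,m}` whose indicator vector
`z` satisfies `∑ i, (A⊗z)_i · y_i < 0`, where on each row
`(A⊗z)_i = max {z_j : A i j = 0}`. -/
theorem set_cover_iff_descent_inner_product_neg (n m k : ℕ) (hn : 0 < n)
    (hk : 1 < k) (hkm : k < m)
    (F : Fin m → Finset (Fin n))
    (hcov : ∀ i : Fin n, ∃ j, i ∈ F j)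
    (a b c : ℝ)
    (ha : a = -(((m : ℝ) - k - 1) / 2)) (hb : b = 1)
    (hc : c = -((((m : ℝ) - k - 1) / 2 + 1) * (m : ℝ) ^ 2)) :
    (∃ J : Finset (Fin m), J.card = k - 1 ∧ ∀ i : Fin n, ∃ j ∈ J, i ∈ F j)
      ↔ (∃ J' : Finset (Fin m), J'.Nonempty ∧
          (∑ i : Fin n,
              ((Finset.univ.filter fun j => i ∈ F j).sup'
                (by obtain ⟨j, hj⟩ := hcov i; exact ⟨j, by simp [hj]⟩)
                (fun j => if j ∈ J' then (1 : ℝ) else 0)) * c)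
            + (∑ j : Fin m, (if j ∈ J' then (1 : ℝ) else 0) * a)
            + (∑ s : {s : Finset (Fin m) // s.card = 2},
                (s.1.sup' (Finset.card_pos.mp (by rw [s.2]; norm_num))
                  (fun j => if j ∈ J' then (1 : ℝ) else 0)) * b)
            + (Finset.univ.sup' (Finset.univ_nonempty_iff.mpr ⟨⟨0, by omega⟩⟩)
                (fun j => if j ∈ J' then (1 : ℝ) else 0))
                * (-(n : ℝ) * c - (m : ℝ) * a - (m : ℝ) * ((m : ℝ) - 1) / 2 * b)
            < 0) := by
  refine Iff.trans ?_ (exists_congr fun J' => and_congr_right fun hJ' =>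
    (?_ : ((∀ i : Fin n, ∃ j ∈ J', i ∈ F j) ∧ J'.card < k) ↔ _))
  · constructor
    · rintro ⟨J, hJ, hcover⟩
      exact ⟨J, Finset.card_pos.mp (by omega), hcover, by omega⟩
    · rintro ⟨J', -, hcover, hJ'⟩
      obtain ⟨J, hsub, -, hJ⟩ := Finset.exists_subsuperset_card_eq
        (n := k - 1) (Finset.subset_univ J') (by omega) (by simp; omega)
      refine ⟨J, hJ, fun i => ?_⟩
      obtain ⟨j, hj, hij⟩ := hcover i
      exact ⟨j, hsub hj, hij⟩
  · have hp : 0 < J'.card := hJ'.card_pos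
    have hpm : J'.card ≤ m := by simpa using J'.card_le_univ
    have hcompl : J'ᶜ.card = m - J'.card := by simp [Finset.card_compl]
    have hu : (Finset.univ.filter fun i : Fin n =>
        Disjoint (Finset.univ.filter fun j => i ∈ F j) J').card = 0 ↔
        ∀ i : Fin n, ∃ j ∈ J', i ∈ F j := by
      simp [Finset.card_eq_zero, Finset.filter_eq_empty_iff, Finset.not_disjoint_iff, and_comm]
    have hq : m - J'.card < m := by omega
    have hqk : m < m - J'.card + k ↔ J'.card < k := by omega
    have huniv : ¬ Disjoint (Finset.univ : Finset (Fin m)) J' := by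
      obtain ⟨j, hj⟩ := hJ'
      exact Finset.not_disjoint_iff.mpr ⟨j, Finset.mem_univ j, hj⟩
    have hind : ∑ j : Fin m, (if j ∈ J' then (1 : ℝ) else 0) = J'.card := by simp
    rw [← hu, ← hqk, ← reduced_inner_product_neg_iff hk hkm hq]
    simp only [← Finset.sum_mul, sum_pairs_sup'_indicator, hind]
    simp only [sup'_indicator_eq, if_neg huniv, Finset.sum_sub_distrib, Finset.sum_boole,
      Finset.sum_const, Finset.card_univ, Fintype.card_fin, hcompl, Nat.cast_choose_two,
      Nat.cast_sub hpm, nsmul_eq_mul]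
    rw [ha, hb, hc]
    refine iff_of_eq (congrArg (· < (0 : ℝ)) ?_)
    ring
end
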